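/- arXiv:1810.09790 — 2 statements merged into one kernel-verified Lean document; each statement's English description precedes it below -/
import Mathlib

section
/- For α ∈ ℝ_{>0}^k and s ∈ ℝ^k, the n-th moment of the Dirichlet distribution satisfies: (n!/(|α|)_n) Σ_{m ∈ ℕ_0^k, |m|=n} (s^m / m!) (α)_m = (n!/(|α|)_n) Z_n(s·α, s^{∘2}·α, ..., s^{∘n}·α), where (α)_m = Π_i (α_i)_{m_i}, s^m = Π_i s_i^{m_i}, s^{∘j}·α = Σ_i s_i^j α_i, |α| = Σ_i α_i, and Z_n is the cycle index polynomial of S_n. More generally this polynomial identity holds for all α ∈ ℂ^k with |α| ∉ ℤ_{≤0}. -/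
open scoped Classical

/-- The number of cycles of length `i` of a permutation of `Fin n`
(fixed points counted as cycles of length 1). -/
noncomputable def cycleCount (n : ℕ) (π : Equiv.Perm (Fin n)) (i : ℕ) : ℕ :=
  (Finset.univ.filter fun x : Fin n => Function.minimalPeriod (⇑π) x = i).card / i

/-- The cycle index polynomial of the symmetric group `S_n`, over `ℂ`. -/
noncomputable def cycleIndexC (n : ℕ) (t : ℕ → ℂ) : ℂ :=
  (n.factorial : ℂ)⁻¹ *
    ∑ π : Equiv.Perm (Fin n), ∏ i ∈ Finset.Icc 1 n, t i ^ cycleCount n π i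

/-- The term `t^λ / z_λ` of the cycle index attached to a multiset `λ` of cycle lengths. -/
noncomputable def cycleTypeWeight (t : ℕ → ℂ) (m : Multiset ℕ) : ℂ :=
  (m.map t).prod / ((m.prod : ℂ) * ∏ i ∈ m.toFinset, ((m.count i).factorial : ℂ))

/-- The multisets of positive natural numbers with sum `n`. -/
noncomputable def partsFinset (n : ℕ) : Finset (Multiset ℕ) :=
  Finset.univ.image (Nat.Partition.parts (n := n))

theorem mem_partsFinset {n : ℕ} {m : Multiset ℕ} :
    m ∈ partsFinset n ↔ m.sum = n ∧ ∀ i ∈ m, 0 < i := by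
  simp only [partsFinset, Finset.mem_image, Finset.mem_univ, true_and]
  constructor
  · rintro ⟨p, rfl⟩
    exact ⟨p.parts_sum, fun i hi => p.parts_pos hi⟩
  · rintro ⟨h, h'⟩
    exact ⟨⟨m, fun {i} hi => h' i hi, h⟩, rfl⟩

theorem prod_count_factorial_of_subset (m : Multiset ℕ) {S : Finset ℕ} (h : m.toFinset ⊆ S) :
    ∏ i ∈ m.toFinset, (m.count i).factorial = ∏ i ∈ S, (m.count i).factorial := by
  refine Finset.prod_subset h fun i _ hi => ?_
  rw [Multiset.count_eq_zero_of_notMem (by simpa using hi), Nat.factorial_zero]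

theorem prod_count_factorial_cons (m : Multiset ℕ) (j : ℕ) :
    ∏ i ∈ (j ::ₘ m).toFinset, ((j ::ₘ m).count i).factorial =
      (j ::ₘ m).count j * ∏ i ∈ m.toFinset, (m.count i).factorial := by
  rw [prod_count_factorial_of_subset m (S := (j ::ₘ m).toFinset) (by simp),
    ← Finset.mul_prod_erase _ _ (a := j) (by simp),
    ← Finset.mul_prod_erase (s := (j ::ₘ m).toFinset) _ (a := j) (by simp), ← mul_assoc]
  congr 1
  · rw [Multiset.count_cons_self, Nat.factorial_succ]
  · refine Finset.prod_congr rfl fun i hi => ?_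
    rw [Multiset.count_cons_of_ne (Finset.ne_of_mem_erase hi)]

theorem cycleTypeWeight_cons (t : ℕ → ℂ) (m : Multiset ℕ) {j : ℕ} (hj : 0 < j) :
    ((j ::ₘ m).count j * j : ℕ) * cycleTypeWeight t (j ::ₘ m) = t j * cycleTypeWeight t m := by
  have hc : ((j ::ₘ m).count j : ℂ) ≠ 0 := by simp; norm_cast
  have hj' : (j : ℂ) ≠ 0 := by exact_mod_cast hj.ne'
  have h := congrArg (Nat.cast : ℕ → ℂ) (prod_count_factorial_cons m j)
  simp only [Nat.cast_mul, Nat.cast_prod] at h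
  rw [cycleTypeWeight, cycleTypeWeight, h, Multiset.map_cons, Multiset.prod_cons,
    Multiset.prod_cons]
  simp only [Nat.cast_mul]
  generalize ((j ::ₘ m).count j : ℂ) = c at *
  rw [mul_div_assoc', mul_div_assoc', show (j : ℂ) * (m.prod : ℂ) * (c *
    ∏ i ∈ m.toFinset, ((m.count i).factorial : ℂ)) = (c * j) * (m.prod *
    ∏ i ∈ m.toFinset, ((m.count i).factorial : ℂ)) by ring,
    mul_div_mul_left _ _ (mul_ne_zero hc hj')]

theorem succ_mul_sum_cycleTypeWeight (t : ℕ → ℂ) (n : ℕ) :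
    ((n + 1 : ℕ) : ℂ) * ∑ m ∈ partsFinset (n + 1), cycleTypeWeight t m =
      ∑ ab ∈ Finset.HasAntidiagonal.antidiagonal n,
        (∑ m ∈ partsFinset ab.1, cycleTypeWeight t m) * t (ab.2 + 1) := by
  have h1 : ∀ m ∈ partsFinset (n + 1), ((n + 1 : ℕ) : ℂ) * cycleTypeWeight t m =
      ∑ j ∈ m.toFinset, ((m.count j * j : ℕ) : ℂ) * cycleTypeWeight t m := by
    intro m hm
    rw [← Finset.sum_mul, ← Nat.cast_sum]
    congr 2
    rw [← (mem_partsFinset.1 hm).1, Finset.sum_multiset_count]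
    simp
  simp_rw [Finset.mul_sum, Finset.sum_mul]
  rw [Finset.sum_congr rfl h1, Finset.sum_sigma', Finset.sum_sigma']
  symm
  refine Finset.sum_bij' (fun x _ => ⟨(x.1.2 + 1) ::ₘ x.2, x.1.2 + 1⟩)
    (fun y _ => ⟨((y.1.erase y.2).sum, y.2 - 1), y.1.erase y.2⟩) ?_ ?_ ?_ ?_ ?_
  · rintro ⟨⟨a, b⟩, m⟩ h
    simp only [Finset.mem_sigma, Finset.HasAntidiagonal.mem_antidiagonal, mem_partsFinset] at h ⊢
    refine ⟨⟨?_, ?_⟩, by simp⟩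
    · rw [Multiset.sum_cons, h.2.1]; omega
    · intro i hi
      rcases Multiset.mem_cons.1 hi with rfl | hi
      · omega
      · exact h.2.2 i hi
  · rintro ⟨m, j⟩ h
    simp only [Finset.mem_sigma, Finset.HasAntidiagonal.mem_antidiagonal, mem_partsFinset,
      Multiset.mem_toFinset] at h ⊢
    have hs := Multiset.sum_erase h.2
    have hp := h.1.2 j h.2
    refine ⟨?_, trivial, fun i hi => h.1.2 i (Multiset.mem_of_mem_erase hi)⟩
    omega
  · rintro ⟨⟨a, b⟩, m⟩ h
    simp only [Finset.mem_sigma, Finset.HasAntidiagonal.mem_antidiagonal, mem_partsFinset] at h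
    simp [h.2.1]
  · rintro ⟨m, j⟩ h
    simp only [Finset.mem_sigma, mem_partsFinset, Multiset.mem_toFinset] at h
    have hp := h.1.2 j h.2
    have hj : j - 1 + 1 = j := by omega
    simp [hj, Multiset.cons_erase h.2]
  · rintro ⟨⟨a, b⟩, m⟩ h
    simp only
    rw [cycleTypeWeight_cons t m (Nat.succ_pos b), mul_comm]

theorem minimalPeriod_eq_card_support_cycleOf {n : ℕ} (π : Equiv.Perm (Fin n)) {x : Fin n}
    (hx : x ∈ π.support) : Function.minimalPeriod π x = (π.cycleOf x).support.card := by
  have hc := Equiv.Perm.isCycleOn_support_cycleOf π x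
  have hx' : x ∈ (π.cycleOf x).support := by
    rw [Equiv.Perm.mem_support_cycleOf_iff]
    exact ⟨Equiv.Perm.SameCycle.refl _ _, hx⟩
  refine Nat.dvd_right_iff_eq.1 fun k => ?_
  rw [← Function.isPeriodicPt_iff_minimalPeriod_dvd, ← hc.pow_apply_eq hx',
    Function.IsPeriodicPt, Function.IsFixedPt, Equiv.Perm.iterate_eq_pow]

theorem card_filter_minimalPeriod {n : ℕ} (π : Equiv.Perm (Fin n)) (i : ℕ) :
    (Finset.univ.filter fun x : Fin n => Function.minimalPeriod π x = i).card =
      π.partition.parts.count i * i := by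
  rw [Equiv.Perm.parts_partition, Multiset.count_add, Fintype.card_fin]
  by_cases hi : i = 1
  · subst hi
    have h1 : π.cycleType.count 1 = 0 := Multiset.count_eq_zero_of_notMem fun h => by
      simpa using Equiv.Perm.one_lt_of_mem_cycleType h
    have h2 : (Finset.univ.filter fun x : Fin n => Function.minimalPeriod π x = 1) =
        π.supportᶜ := by
      ext x
      simp [Function.minimalPeriod_eq_one_iff_isFixedPt, Function.IsFixedPt]
    rw [h1, h2, Finset.card_compl, Multiset.count_replicate_self, Fintype.card_fin]
    simp
  · have h1 : (Finset.univ.filter fun x : Fin n => Function.minimalPeriod π x = i) =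
        (π.cycleFactorsFinset.filter fun c => i = c.support.card).biUnion
          Equiv.Perm.support := by
      ext x
      simp only [Finset.mem_filter, Finset.mem_univ, true_and, Finset.mem_biUnion]
      constructor
      · intro h
        have hx : x ∈ π.support := by
          rw [Equiv.Perm.mem_support]
          intro hx
          exact hi (h ▸ Function.minimalPeriod_eq_one_iff_isFixedPt.2 hx)
        refine ⟨π.cycleOf x, ⟨Equiv.Perm.cycleOf_mem_cycleFactorsFinset_iff.2 hx, ?_⟩, ?_⟩
        · rw [← h, minimalPeriod_eq_card_support_cycleOf π hx]
        · rw [Equiv.Perm.mem_support_cycleOf_iff]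
          exact ⟨Equiv.Perm.SameCycle.refl _ _, hx⟩
      · rintro ⟨c, ⟨hc, rfl⟩, hx⟩
        rw [minimalPeriod_eq_card_support_cycleOf π
          (Equiv.Perm.mem_cycleFactorsFinset_support_le hc hx),
          ← Equiv.Perm.cycle_is_cycleOf hx hc]
    rw [h1, Finset.card_biUnion, Finset.sum_congr rfl (g := fun _ => i), Finset.sum_const,
      Multiset.count_replicate, if_neg (fun h => hi h.symm), add_zero, smul_eq_mul,
      Equiv.Perm.cycleType_def, Multiset.count_map]
    · rfl
    · intro c hc
      exact (Finset.mem_filter.1 hc).2.symm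
    · intro c hc d hd hcd
      exact (Equiv.Perm.cycleFactorsFinset_pairwise_disjoint π
        (Finset.mem_filter.1 hc).1 (Finset.mem_filter.1 hd).1 hcd).disjoint_support

theorem prod_pow_cycleCount (n : ℕ) (t : ℕ → ℂ) (π : Equiv.Perm (Fin n)) :
    ∏ i ∈ Finset.Icc 1 n, t i ^ cycleCount n π i = (π.partition.parts.map t).prod := by
  rw [Finset.prod_multiset_map_count]
  have hsub : π.partition.parts.toFinset ⊆ Finset.Icc 1 n := by
    intro i hi
    rw [Multiset.mem_toFinset] at hi
    have h := Multiset.le_sum_of_mem hi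
    rw [π.partition.parts_sum, Fintype.card_fin] at h
    exact Finset.mem_Icc.2 ⟨π.partition.parts_pos hi, h⟩
  rw [Finset.prod_subset hsub]
  · refine Finset.prod_congr rfl fun i hi => ?_
    rw [← Nat.mul_div_cancel (π.partition.parts.count i)
      (show 0 < i from (Finset.mem_Icc.1 hi).1), ← card_filter_minimalPeriod, cycleCount]
  · intro i _ hi
    rw [Multiset.count_eq_zero_of_notMem (by simpa using hi), pow_zero]

theorem card_perm_partition_mul {n : ℕ} {m : Multiset ℕ} (hm : m ∈ partsFinset n) :
    (Finset.univ.filter fun π : Equiv.Perm (Fin n) => π.partition.parts = m).card *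
      (m.prod * ∏ i ∈ m.toFinset, (m.count i).factorial) = n.factorial := by
  obtain ⟨hsum, hpos⟩ := mem_partsFinset.1 hm
  obtain ⟨c, r, hc, rfl⟩ : ∃ (c : Multiset ℕ) (r : ℕ), (∀ a ∈ c, 2 ≤ a) ∧
      m = c + Multiset.replicate r 1 := by
    refine ⟨m.filter (2 ≤ ·), (m.filter (¬ 2 ≤ ·)).card, fun a ha => Multiset.of_mem_filter ha, ?_⟩
    conv_lhs => rw [← Multiset.filter_add_not (2 ≤ ·) m]
    congr 1
    refine Multiset.eq_replicate_card.2 fun b hb => ?_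
    have h1 := Multiset.of_mem_filter hb
    have h2 := hpos b (Multiset.mem_of_mem_filter hb)
    omega
  rw [Multiset.sum_add, Multiset.sum_replicate, smul_eq_mul, mul_one] at hsum
  have hset : (Finset.univ.filter fun π : Equiv.Perm (Fin n) =>
      π.partition.parts = c + Multiset.replicate r 1) =
      Finset.univ.filter fun π : Equiv.Perm (Fin n) => π.cycleType = c := by
    refine Finset.filter_congr fun π _ => ⟨fun h => ?_, fun h => ?_⟩
    · rw [← Equiv.Perm.filter_parts_partition_eq_cycleType, h, Multiset.filter_add,
        Multiset.filter_eq_self.2 hc, Multiset.filter_eq_nil.2, add_zero]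
      intro a ha
      rw [Multiset.eq_of_mem_replicate ha]
      decide
    · rw [Equiv.Perm.parts_partition, h, ← Equiv.Perm.sum_cycleType, h, Fintype.card_fin,
        ← hsum, Nat.add_sub_cancel_left]
  have h1c : 1 ∉ c := fun h => by simpa using hc 1 h
  have hprod : ∏ i ∈ (c + Multiset.replicate r 1).toFinset,
      ((c + Multiset.replicate r 1).count i).factorial =
      r.factorial * ∏ i ∈ c.toFinset, (c.count i).factorial := by
    rw [prod_count_factorial_of_subset (S := insert 1 c.toFinset),
      Finset.prod_insert (by simpa using h1c)]
    · congr 1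
      · simp [Multiset.count_eq_zero_of_notMem h1c]
      · refine Finset.prod_congr rfl fun i hi => ?_
        have : 1 ≠ i := by
          rintro rfl
          exact h1c (by simpa using hi)
        rw [Multiset.count_add, Multiset.count_replicate, if_neg this, add_zero]
    · intro i hi
      rw [Multiset.mem_toFinset, Multiset.mem_add] at hi
      rw [Finset.mem_insert, Multiset.mem_toFinset]
      exact hi.symm.imp_left Multiset.eq_of_mem_replicate
  have key := Equiv.Perm.card_of_cycleType_mul_eq (Fin n) c
  rw [Fintype.card_fin, if_pos ⟨by omega, hc⟩, ← hsum, Nat.add_sub_cancel_left, hsum] at key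
  rw [hset, hprod, Multiset.prod_add, Multiset.prod_replicate, one_pow, mul_one, ← key]
  convert congrArg _ _ using 2
  ring

theorem cycleIndexC_eq_sum_cycleTypeWeight (n : ℕ) (t : ℕ → ℂ) :
    cycleIndexC n t = ∑ m ∈ partsFinset n, cycleTypeWeight t m := by
  have hmaps : ∀ π ∈ (Finset.univ : Finset (Equiv.Perm (Fin n))),
      π.partition.parts ∈ partsFinset n := fun π _ =>
    mem_partsFinset.2 ⟨π.partition.parts_sum.trans (Fintype.card_fin n),
      fun i hi => π.partition.parts_pos hi⟩
  simp only [cycleIndexC, prod_pow_cycleCount]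
  rw [← Finset.sum_fiberwise_of_maps_to hmaps, Finset.mul_sum]
  refine Finset.sum_congr rfl fun m hm => ?_
  rw [Finset.sum_congr rfl (g := fun _ => (m.map t).prod)
    (fun π hπ => by rw [(Finset.mem_filter.1 hπ).2]), Finset.sum_const, nsmul_eq_mul,
    cycleTypeWeight]
  have h := card_perm_partition_mul hm
  have hne := h ▸ n.factorial_ne_zero
  have h' := congrArg (Nat.cast : ℕ → ℂ) h
  have hne' := (Nat.cast_ne_zero (R := ℂ)).2 hne
  simp only [Nat.cast_mul, Nat.cast_prod] at h' hne'
  rw [← h', mul_inv, div_eq_mul_inv]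
  have hcard := left_ne_zero_of_mul hne'
  field_simp

/-- Coefficients of the binomial series `(1 - s X) ^ (-α)`. -/
noncomputable def binomialCoeff (α s : ℂ) (m : ℕ) : ℂ :=
  s ^ m / (m.factorial : ℂ) * (ascPochhammer ℂ m).eval α

theorem succ_mul_binomialCoeff (α s : ℂ) (m : ℕ) :
    ((m : ℂ) + 1) * binomialCoeff α s (m + 1) = s * (α + m) * binomialCoeff α s m := by
  have h1 : (m.factorial : ℂ) ≠ 0 := by exact_mod_cast m.factorial_ne_zero
  have h2 : (m : ℂ) + 1 ≠ 0 := by exact_mod_cast m.succ_ne_zero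
  rw [binomialCoeff, binomialCoeff, ascPochhammer_succ_eval, Nat.factorial_succ]
  push_cast
  field_simp
  ring

theorem derivative_binomialSeries (α s : ℂ) :
    PowerSeries.derivative (R := ℂ) (PowerSeries.mk (binomialCoeff α s)) =
      PowerSeries.mk (binomialCoeff α s) * PowerSeries.mk fun j => s ^ (j + 1) * α := by
  ext n
  rw [PowerSeries.coeff_derivative, PowerSeries.coeff_mul]
  simp only [PowerSeries.coeff_mk]
  induction n with
  | zero => simpa [mul_comm, mul_assoc] using succ_mul_binomialCoeff α s 0
  | succ n ih =>
    rw [Finset.Nat.antidiagonal_succ', Finset.sum_cons, Finset.sum_map]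
    have h : ∑ x ∈ Finset.HasAntidiagonal.antidiagonal n, binomialCoeff α s x.1 * (s ^ (x.2 + 1 + 1) * α) =
        s * ∑ x ∈ Finset.HasAntidiagonal.antidiagonal n, binomialCoeff α s x.1 * (s ^ (x.2 + 1) * α) := by
      rw [Finset.mul_sum]
      exact Finset.sum_congr rfl fun x _ => by ring
    simp
    rw [h, ← ih]
    have := succ_mul_binomialCoeff α s (n + 1)
    push_cast at this
    linear_combination this

theorem derivative_prod_eq_mul_sum {ι : Type*} (S : Finset ι) (f q : ι → PowerSeries ℂ)
    (h : ∀ i ∈ S, PowerSeries.derivative (R := ℂ) (f i) = f i * q i) :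
    PowerSeries.derivative (R := ℂ) (∏ i ∈ S, f i) = (∏ i ∈ S, f i) * ∑ i ∈ S, q i := by
  induction S using Finset.induction_on with
  | empty => simp
  | insert a S ha ih =>
    rw [Finset.prod_insert ha, Finset.sum_insert ha, Derivation.leibniz,
      ih fun i hi => h i (Finset.mem_insert_of_mem hi), h a (Finset.mem_insert_self a S),
      smul_eq_mul, smul_eq_mul]
    ring

theorem coeff_prod_eq_sum_antidiagonalTuple (k n : ℕ) (f : Fin k → ℕ → ℂ) :
    PowerSeries.coeff n (∏ i, PowerSeries.mk (f i)) =
      ∑ m ∈ Finset.Nat.antidiagonalTuple k n, ∏ i, f i (m i) := by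
  rw [PowerSeries.coeff_prod]
  refine Finset.sum_bij' (fun l _ => ⇑l) (fun m _ => Finsupp.equivFunOnFinite.symm m)
    ?_ ?_ ?_ ?_ ?_
  · intro l hl
    exact Finset.Nat.mem_antidiagonalTuple.2 (Finset.mem_finsuppAntidiag.1 hl).1
  · intro m hm
    exact Finset.mem_finsuppAntidiag.2
      ⟨Finset.Nat.mem_antidiagonalTuple.1 hm, Finset.subset_univ _⟩
  · intro l _
    ext i
    rfl
  · intro m _
    rfl
  · intro l _
    simp only [PowerSeries.coeff_mk]

theorem eq_of_convolution_recurrence {f g t : ℕ → ℂ} (h0 : f 0 = g 0)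
    (hf : ∀ n, ((n + 1 : ℕ) : ℂ) * f (n + 1) = ∑ ab ∈ Finset.HasAntidiagonal.antidiagonal n, f ab.1 * t ab.2)
    (hg : ∀ n, ((n + 1 : ℕ) : ℂ) * g (n + 1) = ∑ ab ∈ Finset.HasAntidiagonal.antidiagonal n, g ab.1 * t ab.2)
    (n : ℕ) : f n = g n := by
  induction n using Nat.strong_induction_on with
  | _ n ih =>
    cases n with
    | zero => exact h0
    | succ n =>
      refine mul_left_cancel₀ (Nat.cast_ne_zero.2 n.succ_ne_zero : ((n + 1 : ℕ) : ℂ) ≠ 0) ?_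
      rw [hf, hg]
      refine Finset.sum_congr rfl fun ab hab => ?_
      have := Finset.HasAntidiagonal.mem_antidiagonal.1 hab
      rw [ih ab.1 (by omega)]

theorem sum_antidiagonalTuple_eq_cycleIndexC (k n : ℕ) (α s : Fin k → ℂ) :
    ∑ m ∈ Finset.Nat.antidiagonalTuple k n, ∏ i, binomialCoeff (α i) (s i) (m i) =
      cycleIndexC n (fun j => ∑ i, s i ^ j * α i) := by
  rw [cycleIndexC_eq_sum_cycleTypeWeight]
  refine eq_of_convolution_recurrence
    (f := fun n => ∑ m ∈ Finset.Nat.antidiagonalTuple k n, ∏ i, binomialCoeff (α i) (s i) (m i))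
    (g := fun n => ∑ m ∈ partsFinset n, cycleTypeWeight (fun j => ∑ i, s i ^ j * α i) m)
    (t := fun j => ∑ i, s i ^ (j + 1) * α i) ?_ ?_
    (fun n => succ_mul_sum_cycleTypeWeight _ n) n
  · have h : partsFinset 0 = {0} := by
      ext m
      rw [mem_partsFinset, Finset.mem_singleton]
      constructor
      · rintro ⟨h, h'⟩
        refine Multiset.eq_zero_of_forall_notMem fun i hi => ?_
        have := Multiset.le_sum_of_mem hi
        have := h' i hi
        omega
      · rintro rfl
        simp
    simp [h, cycleTypeWeight, binomialCoeff, Finset.Nat.antidiagonalTuple_zero_right]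
  · intro n
    have h := congrArg (PowerSeries.coeff n) (derivative_prod_eq_mul_sum Finset.univ
      (fun i => PowerSeries.mk (binomialCoeff (α i) (s i)))
      (fun i => PowerSeries.mk fun j => s i ^ (j + 1) * α i)
      fun i _ => derivative_binomialSeries (α i) (s i))
    rw [PowerSeries.coeff_derivative, PowerSeries.coeff_mul] at h
    simp only [coeff_prod_eq_sum_antidiagonalTuple, map_sum, PowerSeries.coeff_mk] at h
    rw [← h]
    push_cast
    ring

/-- Moment formula for the Dirichlet distribution:
`(n!/(|α|)_n) Σ_{|m|=n} (s^m/m!)(α)_m = (n!/(|α|)_n) Z_n(s·α, s^{∘2}·α, ..., s^{∘n}·α)`,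
as a polynomial identity valid for all `α ∈ ℂ^k` with `|α| ∉ ℤ_{≤0}`
(in particular for `α ∈ ℝ_{>0}^k` and `s ∈ ℝ^k`). -/
theorem dirichlet_moment_cycleIndex (k n : ℕ) (α s : Fin k → ℂ)
    (hα : ∀ z : ℤ, z ≤ 0 → (∑ i, α i) ≠ (z : ℂ)) :
    (n.factorial : ℂ) / (ascPochhammer ℂ n).eval (∑ i, α i) *
        ∑ m ∈ Finset.Nat.antidiagonalTuple k n,
          (∏ i, s i ^ m i) / (∏ i, ((m i).factorial : ℂ)) *
            ∏ i, (ascPochhammer ℂ (m i)).eval (α i)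
      = (n.factorial : ℂ) / (ascPochhammer ℂ n).eval (∑ i, α i) *
          cycleIndexC n (fun j => ∑ i, s i ^ j * α i) := by
  congr 1
  rw [← sum_antidiagonalTuple_eq_cycleIndexC]
  refine Finset.sum_congr rfl fun m _ => ?_
  simp only [binomialCoeff, Finset.prod_mul_distrib, Finset.prod_div_distrib]
end

section
/- As β → 0+, the Dirichlet distribution Dir(βα) on Δ^{k-1} converges weakly (narrowly) to the discrete measure |α|^{-1} Σ_{i=1}^k α_i δ_{e_i}, and as β → +∞ it converges weakly to the Dirac measure δ_{α/|α|}. -/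
open MeasureTheory Filter
open scoped Classical Topology

/-- The Dirichlet distribution with parameter `α ∈ ℝ^{k+1}` on the standard simplex
`Δ^k ⊂ ℝ^{k+1}`, realized as the image under `z ↦ (z, 1 - Σz)` of the measure on the
corner simplex with density `y^{α-1}/B(α)` with respect to Lebesgue measure. -/
noncomputable def dirichlet {k : ℕ} (α : Fin (k + 1) → ℝ) :
    Measure (Fin (k + 1) → ℝ) :=
  Measure.map (fun z : Fin k → ℝ => Fin.snoc z (1 - ∑ i, z i))
    ((volume : Measure (Fin k → ℝ)).withDensity fun z =>
      ENNReal.ofReal <|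
        if (∀ i, 0 ≤ z i) ∧ ∑ i, z i ≤ 1 then
          (Real.Gamma (∑ i, α i) / ∏ i, Real.Gamma (α i)) *
            (∏ i : Fin k, z i ^ (α i.castSucc - 1)) * (1 - ∑ i, z i) ^ (α (Fin.last k) - 1)
        else 0)

/-- The one-variable factor of the Dirichlet density: `t ^ (a - 1)` on `[0, ∞)`, zero elsewhere. -/
noncomputable def rpowDensity (a t : ℝ) : ENNReal :=
  if 0 ≤ t then ENNReal.ofReal (t ^ (a - 1)) else 0

@[fun_prop]
lemma measurable_rpowDensity (a : ℝ) : Measurable (rpowDensity a) :=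
  Measurable.ite measurableSet_Ici (by fun_prop) measurable_const

lemma rpowDensity_of_nonneg (a : ℝ) {t : ℝ} (ht : 0 ≤ t) :
    rpowDensity a t = ENNReal.ofReal (t ^ (a - 1)) := if_pos ht

lemma rpowDensity_of_neg (a : ℝ) {t : ℝ} (ht : t < 0) : rpowDensity a t = 0 :=
  if_neg ht.not_ge

lemma rpowDensity_mul (a : ℝ) {s : ℝ} (hs : 0 < s) (t : ℝ) :
    rpowDensity a (s * t) = ENNReal.ofReal (s ^ (a - 1)) * rpowDensity a t := by
  rcases le_or_gt 0 t with ht | ht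
  · rw [rpowDensity_of_nonneg a ht, rpowDensity_of_nonneg a (by positivity),
      ← ENNReal.ofReal_mul (by positivity), Real.mul_rpow hs.le ht]
  · rw [rpowDensity_of_neg a ht, rpowDensity_of_neg a (by nlinarith), mul_zero]

lemma ofReal_mul_rpowDensity {a : ℝ} (ha : 0 < a) (t : ℝ) :
    ENNReal.ofReal t * rpowDensity a t = rpowDensity (a + 1) t := by
  rcases lt_trichotomy t 0 with ht | rfl | ht
  · rw [rpowDensity_of_neg _ ht, rpowDensity_of_neg _ ht, mul_zero]
  · simp [rpowDensity, Real.zero_rpow ha.ne']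
  · rw [rpowDensity_of_nonneg _ ht.le, rpowDensity_of_nonneg _ ht.le,
      ← ENNReal.ofReal_mul ht.le, add_sub_right_comm, Real.rpow_add_one ht.ne', mul_comm]

lemma lintegral_rpowDensity_mul_exp {a : ℝ} (ha : 0 < a) :
    ∫⁻ t, rpowDensity a t * ENNReal.ofReal (Real.exp (-t)) = ENNReal.ofReal (Real.Gamma a) := by
  have h1 : ∀ t : ℝ, t ≠ 0 → rpowDensity a t * ENNReal.ofReal (Real.exp (-t)) =
      (Set.Ioi 0).indicator (fun t => ENNReal.ofReal (Real.exp (-t) * t ^ (a - 1))) t := by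
    intro t ht0
    rcases ht0.lt_or_gt with ht | ht
    · rw [rpowDensity_of_neg _ ht, Set.indicator_of_notMem (by simpa using ht.le), zero_mul]
    · rw [rpowDensity_of_nonneg _ ht.le, Set.indicator_of_mem (by simpa using ht),
        ENNReal.ofReal_mul (by positivity), mul_comm]
  have h2 : ∀ᵐ t : ℝ, t ≠ 0 := by simp [ae_iff]
  rw [lintegral_congr_ae (h2.mono fun t ht => h1 t ht), lintegral_indicator measurableSet_Ioi,
    Real.Gamma_eq_integral ha,
    ofReal_integral_eq_lintegral_ofReal (Real.GammaIntegral_convergent ha)]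
  filter_upwards [self_mem_ae_restrict measurableSet_Ioi] with t ht
  have : (0 : ℝ) < t := ht
  change 0 ≤ Real.exp (-t) * t ^ (a - 1)
  positivity

lemma lintegral_fin_prod_volume_eq_prod {n : ℕ} (f : Fin n → ℝ → ENNReal)
    (hf : ∀ i, Measurable (f i)) :
    ∫⁻ x : Fin n → ℝ, ∏ i, f i (x i) = ∏ i, ∫⁻ t, f i t := by
  induction n with
  | zero => simp [volume_pi]
  | succ n ih =>
    rw [Fin.prod_univ_succ, ← ih _ fun i => hf i.succ,
      ← lintegral_prod_mul (hf 0).aemeasurable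
        (Finset.measurable_prod _ fun i _ => (hf i.succ).comp (measurable_pi_apply i)).aemeasurable,
      ((volume_preserving_piFinSuccAbove (fun _ : Fin (n + 1) => ℝ) 0).symm).lintegral_map_equiv]
    simp [Fin.prod_univ_succ, MeasurableEquiv.piFinSuccAbove_symm_apply, Fin.insertNthEquiv,
      Measure.volume_eq_prod]

lemma lintegral_volume_smul {n : ℕ} {f : (Fin n → ℝ) → ENNReal} (hf : Measurable f) {s : ℝ}
    (hs : 0 < s) : ∫⁻ x, f x = ENNReal.ofReal (s ^ n) * ∫⁻ z, f (s • z) := by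
  have h := lintegral_map (μ := (volume : Measure (Fin n → ℝ))) hf (measurable_const_smul s)
  rw [← h, Measure.map_addHaar_smul _ hs.ne', lintegral_smul_measure, smul_eq_mul, ← mul_assoc,
    abs_of_pos (by positivity), ← ENNReal.ofReal_mul (by positivity), Module.finrank_fin_fun,
    mul_inv_cancel₀ (by positivity), ENNReal.ofReal_one, one_mul]

/-- The parametrization `z ↦ (z, s - Σz)` of the simplex of total mass `s`. -/
noncomputable def snocSum {k : ℕ} (s : ℝ) (z : Fin k → ℝ) : Fin (k + 1) → ℝ :=
  Fin.snoc z (s - ∑ i, z i)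

@[simp]
lemma snocSum_castSucc {k : ℕ} (s : ℝ) (z : Fin k → ℝ) (i : Fin k) :
    snocSum s z i.castSucc = z i := by simp [snocSum]

@[simp]
lemma snocSum_last {k : ℕ} (s : ℝ) (z : Fin k → ℝ) :
    snocSum s z (Fin.last k) = s - ∑ i, z i := by simp [snocSum]

lemma sum_snocSum {k : ℕ} (s : ℝ) (z : Fin k → ℝ) : ∑ i, snocSum s z i = s := by
  simp [Fin.sum_univ_castSucc]

lemma snocSum_smul {k : ℕ} (s : ℝ) (z : Fin k → ℝ) : snocSum s (s • z) = s • snocSum 1 z := by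
  ext i
  refine Fin.lastCases ?_ (fun i => ?_) i
  · simp [← Finset.mul_sum, mul_sub]
  · simp

@[fun_prop]
lemma measurable_snocSum {k : ℕ} : Measurable fun p : ℝ × (Fin k → ℝ) => snocSum p.1 p.2 := by
  refine measurable_pi_lambda _ fun i => ?_
  refine Fin.lastCases ?_ (fun i => ?_) i
  · simp only [snocSum_last]; fun_prop
  · simp only [snocSum_castSucc]; fun_prop

/-- The unnormalized Dirichlet density on nonnegative vectors. -/
noncomputable def dirichletWeight {k : ℕ} (α y : Fin k → ℝ) : ENNReal :=
  ∏ i, rpowDensity (α i) (y i)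

@[fun_prop]
lemma measurable_dirichletWeight {k : ℕ} (α : Fin k → ℝ) : Measurable (dirichletWeight α) := by
  unfold dirichletWeight
  fun_prop

lemma dirichletWeight_eq_zero {k : ℕ} (α : Fin k → ℝ) {y : Fin k → ℝ} {i : Fin k} (hi : y i < 0) :
    dirichletWeight α y = 0 :=
  Finset.prod_eq_zero (Finset.mem_univ i) (rpowDensity_of_neg _ hi)

lemma dirichletWeight_smul {k : ℕ} (α y : Fin k → ℝ) {s : ℝ} (hs : 0 < s) :
    dirichletWeight α (s • y) = ENNReal.ofReal (s ^ (∑ i, α i - k)) * dirichletWeight α y := by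
  have h : s ^ (∑ i, α i - k) = ∏ i, s ^ (α i - 1) := by
    rw [← Real.rpow_sum_of_pos hs]; simp
  simp only [dirichletWeight, Pi.smul_apply, smul_eq_mul, rpowDensity_mul _ hs,
    Finset.prod_mul_distrib, h]
  rw [ENNReal.ofReal_prod_of_nonneg fun i _ => by positivity]

/-- The multivariate Beta integral. -/
lemma ofReal_Gamma_mul_lintegral_dirichletWeight {k : ℕ} {α : Fin (k + 1) → ℝ}
    (hα : ∀ i, 0 < α i) :
    ENNReal.ofReal (Real.Gamma (∑ i, α i)) * ∫⁻ z : Fin k → ℝ, dirichletWeight α (snocSum 1 z) =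
      ∏ i, ENNReal.ofReal (Real.Gamma (α i)) := by
  have hsum : 0 < ∑ i, α i := Finset.sum_pos (fun i _ => hα i) Finset.univ_nonempty
  have hinner : ∀ s : ℝ, s ≠ 0 →
      ∫⁻ x : Fin k → ℝ, dirichletWeight α (snocSum s x) * ENNReal.ofReal (Real.exp (-s)) =
      (rpowDensity (∑ i, α i) s * ENNReal.ofReal (Real.exp (-s))) *
        ∫⁻ z : Fin k → ℝ, dirichletWeight α (snocSum 1 z) := by
    intro s hs0
    rw [lintegral_mul_const _ (by fun_prop)]
    rcases hs0.lt_or_gt with hs | hs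
    · have : ∀ x : Fin k → ℝ, dirichletWeight α (snocSum s x) = 0 := by
        intro x
        obtain ⟨i, -, hi⟩ := Finset.exists_lt_of_sum_lt (s := Finset.univ)
          (f := snocSum s x) (g := 0) (by simpa [sum_snocSum] using hs)
        exact dirichletWeight_eq_zero α hi
      simp [this, rpowDensity_of_neg _ hs]
    · rw [lintegral_volume_smul (by fun_prop) hs]
      simp_rw [snocSum_smul, dirichletWeight_smul _ _ hs]
      rw [lintegral_const_mul _ (by fun_prop), rpowDensity_of_nonneg _ hs.le, ← mul_assoc,
        ← ENNReal.ofReal_mul (by positivity), ← Real.rpow_natCast, ← Real.rpow_add hs]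
      push_cast
      rw [show (k : ℝ) + (∑ i, α i - (k + 1)) = ∑ i, α i - 1 by ring]
      ring
  calc _ = ∫⁻ s : ℝ, ∫⁻ x : Fin k → ℝ,
        dirichletWeight α (snocSum s x) * ENNReal.ofReal (Real.exp (-s)) := by
        have h2 : ∀ᵐ t : ℝ, t ≠ 0 := by simp [ae_iff]
        rw [lintegral_congr_ae (h2.mono fun t ht => hinner t ht),
          lintegral_mul_const _ (by fun_prop), lintegral_rpowDensity_mul_exp hsum]
    _ = ∫⁻ x : Fin k → ℝ, ∫⁻ s : ℝ,
        dirichletWeight α (snocSum s x) * ENNReal.ofReal (Real.exp (-s)) :=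
        lintegral_lintegral_swap (by fun_prop)
    _ = ∫⁻ x : Fin k → ℝ, (∏ i, rpowDensity (α i.castSucc) (x i) *
          ENNReal.ofReal (Real.exp (-x i))) * ∫⁻ t : ℝ, rpowDensity (α (Fin.last k)) t *
          ENNReal.ofReal (Real.exp (-t)) := by
        refine lintegral_congr fun x => ?_
        rw [← lintegral_const_mul _ (by fun_prop), ← lintegral_sub_right_eq_self (fun t => _ *
          (rpowDensity (α (Fin.last k)) t * ENNReal.ofReal (Real.exp (-t)))) (∑ i, x i)]
        refine lintegral_congr fun s => ?_
        have : Real.exp (-s) = (∏ i, Real.exp (-x i)) * Real.exp (-(s - ∑ i, x i)) := by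
          rw [← Real.exp_sum, ← Real.exp_add, Finset.sum_neg_distrib]; ring_nf
        rw [this, ENNReal.ofReal_mul (by positivity),
          ENNReal.ofReal_prod_of_nonneg fun i _ => by positivity]
        simp only [dirichletWeight, Fin.prod_univ_castSucc, snocSum_castSucc, snocSum_last,
          Finset.prod_mul_distrib]
        ring
    _ = _ := by
        rw [lintegral_mul_const _ (by fun_prop), lintegral_fin_prod_volume_eq_prod
          (fun i t => rpowDensity (α i.castSucc) t * ENNReal.ofReal (Real.exp (-t)))
          (fun i => by fun_prop)]
        simp only [lintegral_rpowDensity_mul_exp (hα _), Fin.prod_univ_castSucc]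

lemma lintegral_dirichlet {k : ℕ} {α : Fin (k + 1) → ℝ} (hα : ∀ i, 0 < α i)
    {g : (Fin (k + 1) → ℝ) → ENNReal} (hg : Measurable g) :
    ∫⁻ y, g y ∂(dirichlet α) = ENNReal.ofReal (Real.Gamma (∑ i, α i) / ∏ i, Real.Gamma (α i)) *
      ∫⁻ z : Fin k → ℝ, dirichletWeight α (snocSum 1 z) * g (snocSum 1 z) := by
  have hsum : 0 < ∑ i, α i := Finset.sum_pos (fun i _ => hα i) Finset.univ_nonempty
  have hc : 0 ≤ Real.Gamma (∑ i, α i) / ∏ i, Real.Gamma (α i) :=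
    div_nonneg (Real.Gamma_pos_of_pos hsum).le
      (Finset.prod_nonneg fun i _ => (Real.Gamma_pos_of_pos (hα i)).le)
  have hdens : (fun z : Fin k → ℝ => ENNReal.ofReal <|
        if (∀ i, 0 ≤ z i) ∧ ∑ i, z i ≤ 1 then
          (Real.Gamma (∑ i, α i) / ∏ i, Real.Gamma (α i)) *
            (∏ i : Fin k, z i ^ (α i.castSucc - 1)) * (1 - ∑ i, z i) ^ (α (Fin.last k) - 1)
        else 0) = fun z => ENNReal.ofReal (Real.Gamma (∑ i, α i) / ∏ i, Real.Gamma (α i)) *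
          dirichletWeight α (snocSum 1 z) := by
    ext z
    split_ifs with h
    · obtain ⟨h0, h1⟩ := h
      rw [mul_assoc, ENNReal.ofReal_mul hc, ENNReal.ofReal_mul
        (Finset.prod_nonneg fun i _ => Real.rpow_nonneg (h0 i) _),
        ENNReal.ofReal_prod_of_nonneg fun i _ => Real.rpow_nonneg (h0 i) _]
      simp [dirichletWeight, Fin.prod_univ_castSucc, rpowDensity_of_nonneg, h0, h1]
    · have : ∃ i, snocSum 1 z i < 0 := by
        by_contra! hn
        exact h ⟨fun i => by simpa using hn i.castSucc, by simpa using hn (Fin.last k)⟩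
      obtain ⟨i, hi⟩ := this
      rw [dirichletWeight_eq_zero α hi, mul_zero, ENNReal.ofReal_zero]
  have hm : Measurable fun z : Fin k → ℝ => snocSum 1 z := by fun_prop
  rw [dirichlet, hdens]
  change ∫⁻ y, g y ∂Measure.map (fun z => snocSum 1 z) _ = _
  rw [lintegral_map hg hm, lintegral_withDensity_eq_lintegral_mul (g := fun z => g (snocSum 1 z)) _
    (by fun_prop) (hg.comp hm), ← lintegral_const_mul _ (by fun_prop)]
  simp only [Pi.mul_apply, mul_assoc]

lemma isProbabilityMeasure_dirichlet {k : ℕ} {α : Fin (k + 1) → ℝ} (hα : ∀ i, 0 < α i) :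
    IsProbabilityMeasure (dirichlet α) := by
  have hsum : 0 < ∑ i, α i := Finset.sum_pos (fun i _ => hα i) Finset.univ_nonempty
  have hprod : 0 < ∏ i, Real.Gamma (α i) :=
    Finset.prod_pos fun i _ => Real.Gamma_pos_of_pos (hα i)
  refine ⟨?_⟩
  rw [← lintegral_one, lintegral_dirichlet hα measurable_const, div_eq_inv_mul,
    ENNReal.ofReal_mul (by positivity)]
  simp only [mul_one]
  rw [mul_assoc, ofReal_Gamma_mul_lintegral_dirichletWeight hα,
    ← ENNReal.ofReal_prod_of_nonneg fun i _ => (Real.Gamma_pos_of_pos (hα i)).le,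
    ← ENNReal.ofReal_mul (by positivity), inv_mul_cancel₀ hprod.ne', ENNReal.ofReal_one]

lemma ae_dirichlet_mem_stdSimplex {k : ℕ} {α : Fin (k + 1) → ℝ} (hα : ∀ i, 0 < α i) :
    ∀ᵐ y ∂(dirichlet α), y ∈ stdSimplex ℝ (Fin (k + 1)) := by
  have hS : MeasurableSet (stdSimplex ℝ (Fin (k + 1)))ᶜ :=
    (isCompact_stdSimplex ℝ (Fin (k + 1))).isClosed.measurableSet.compl
  change dirichlet α (stdSimplex ℝ (Fin (k + 1)))ᶜ = 0
  rw [← lintegral_indicator_one hS, lintegral_dirichlet hα (measurable_one.indicator hS)]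
  have : ∀ z : Fin k → ℝ, dirichletWeight α (snocSum 1 z) *
      (stdSimplex ℝ (Fin (k + 1)))ᶜ.indicator 1 (snocSum 1 z) = 0 := by
    intro z
    by_cases hz : snocSum 1 z ∈ stdSimplex ℝ (Fin (k + 1))
    · simp [hz]
    · have : ∃ i, snocSum 1 z i < 0 := by
        by_contra! hn
        exact hz ⟨hn, sum_snocSum 1 z⟩
      obtain ⟨i, hi⟩ := this
      rw [dirichletWeight_eq_zero α hi, zero_mul]
  simp [this]

lemma add_single_one_pos {n : ℕ} {α : Fin n → ℝ} (hα : ∀ i, 0 < α i) (j : Fin n) (i : Fin n) :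
    0 < (α + Pi.single j 1 : Fin n → ℝ) i := by
  have : (0 : Fin n → ℝ) ≤ Pi.single j 1 := Pi.single_nonneg.2 zero_le_one
  exact add_pos_of_pos_of_nonneg (hα i) (this i)

/-- Weighting a Dirichlet distribution by a coordinate shifts its parameter. -/
lemma lintegral_ofReal_mul_dirichlet {k : ℕ} {α : Fin (k + 1) → ℝ} (hα : ∀ i, 0 < α i)
    (j : Fin (k + 1)) {g : (Fin (k + 1) → ℝ) → ENNReal} (hg : Measurable g) :
    ∫⁻ y, ENNReal.ofReal (y j) * g y ∂(dirichlet α) =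
      ENNReal.ofReal (α j / ∑ i, α i) * ∫⁻ y, g y ∂(dirichlet (α + Pi.single j 1)) := by
  have hsum : 0 < ∑ i, α i := Finset.sum_pos (fun i _ => hα i) Finset.univ_nonempty
  have hprod : 0 < ∏ i, Real.Gamma (α i) :=
    Finset.prod_pos fun i _ => Real.Gamma_pos_of_pos (hα i)
  have hα' := add_single_one_pos hα j
  have hsum' : ∑ i, (α + Pi.single j 1 : Fin (k + 1) → ℝ) i = ∑ i, α i + 1 := by
    simp [Finset.sum_add_distrib]
  have hj : (α + Pi.single j 1 : Fin (k + 1) → ℝ) j = α j + 1 := by simp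
  have hne : ∀ i ∈ Finset.univ.erase j, (α + Pi.single j 1 : Fin (k + 1) → ℝ) i = α i :=
    fun i hi => by simp [Pi.single_eq_of_ne (Finset.ne_of_mem_erase hi)]
  generalize (α + Pi.single j 1 : Fin (k + 1) → ℝ) = α' at *
  have hprod' : ∏ i, Real.Gamma (α' i) = α j * ∏ i, Real.Gamma (α i) := by
    rw [← Finset.mul_prod_erase _ _ (Finset.mem_univ j),
      ← Finset.mul_prod_erase _ (fun i => Real.Gamma (α i)) (Finset.mem_univ j),
      Finset.prod_congr rfl fun i hi => by rw [hne i hi], hj, Real.Gamma_add_one (hα j).ne',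
      mul_assoc]
  have hw : ∀ y, dirichletWeight α y * (ENNReal.ofReal (y j) * g y) =
      dirichletWeight α' y * g y := by
    intro y
    rw [dirichletWeight, dirichletWeight, ← Finset.mul_prod_erase _ _ (Finset.mem_univ j),
      ← Finset.mul_prod_erase _ (fun i => rpowDensity (α' i) (y i)) (Finset.mem_univ j),
      Finset.prod_congr rfl (f := fun i => rpowDensity (α' i) (y i)) fun i hi => by rw [hne i hi],
      hj, ← ofReal_mul_rpowDensity (hα j)]
    ring
  rw [lintegral_dirichlet hα (by fun_prop), lintegral_dirichlet hα' hg, hsum', hprod']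
  simp_rw [hw]
  rw [← mul_assoc, ← ENNReal.ofReal_mul (div_nonneg (hα j).le hsum.le),
    Real.Gamma_add_one hsum.ne']
  congr 2
  have := (hα j).ne'
  field_simp

lemma integral_eval_dirichlet {k : ℕ} {α : Fin (k + 1) → ℝ} (hα : ∀ i, 0 < α i)
    (j : Fin (k + 1)) : ∫ y, y j ∂(dirichlet α) = α j / ∑ i, α i := by
  have hsum : 0 < ∑ i, α i := Finset.sum_pos (fun i _ => hα i) Finset.univ_nonempty
  have hα' := add_single_one_pos hα j
  have := isProbabilityMeasure_dirichlet hα'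
  have h := lintegral_ofReal_mul_dirichlet hα j (g := fun _ => 1) measurable_const
  rw [integral_eq_lintegral_of_nonneg_ae
    ((ae_dirichlet_mem_stdSimplex hα).mono fun y hy => hy.1 j)
    (measurable_pi_apply j).aestronglyMeasurable]
  simp only [mul_one, lintegral_one, measure_univ] at h
  rw [h, ENNReal.toReal_ofReal (div_nonneg (hα j).le hsum.le)]

lemma integral_eval_sq_dirichlet {k : ℕ} {α : Fin (k + 1) → ℝ} (hα : ∀ i, 0 < α i)
    (j : Fin (k + 1)) : ∫ y, y j ^ 2 ∂(dirichlet α) =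
      α j / (∑ i, α i) * ((α j + 1) / (∑ i, α i + 1)) := by
  have hsum : 0 < ∑ i, α i := Finset.sum_pos (fun i _ => hα i) Finset.univ_nonempty
  have hα' := add_single_one_pos hα j
  have hα'' := add_single_one_pos hα' j
  have := isProbabilityMeasure_dirichlet hα''
  have h := lintegral_ofReal_mul_dirichlet hα' j (g := fun _ => 1) measurable_const
  have h2 := lintegral_ofReal_mul_dirichlet hα j (g := fun y => ENNReal.ofReal (y j)) (by fun_prop)
  simp only [mul_one, lintegral_one, measure_univ] at h
  rw [h] at h2
  have hj := hα j
  rw [integral_eq_lintegral_of_nonneg_ae (.of_forall fun y => sq_nonneg _)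
      ((measurable_pi_apply j).pow_const 2).aestronglyMeasurable,
    lintegral_congr_ae (g := fun y => ENNReal.ofReal (y j) * ENNReal.ofReal (y j))
      ((ae_dirichlet_mem_stdSimplex hα).mono fun y hy => by
        simp only [sq, ENNReal.ofReal_mul (hy.1 j)]), h2,
    ← ENNReal.ofReal_mul (by positivity), ENNReal.toReal_ofReal]
  · simp [Finset.sum_add_distrib]
  · exact mul_nonneg (by positivity)
      (div_nonneg (hα' j).le (Finset.sum_nonneg fun i _ => (hα' i).le))

lemma IsCompact.exists_abs_le_add_mul {X : Type*} [TopologicalSpace X] {K : Set X}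
    (hK : IsCompact K) {g h : X → ℝ} (hg : Continuous g) (hh : Continuous h)
    (h_nonneg : ∀ y ∈ K, 0 ≤ h y) (hzero : ∀ y ∈ K, h y = 0 → g y = 0) {ε : ℝ} (hε : 0 < ε) :
    ∃ C, ∀ y ∈ K, |g y| ≤ ε + C * h y := by
  obtain ⟨M, hM⟩ := hK.exists_bound_of_continuousOn hg.continuousOn
  have hK' : IsCompact (K ∩ {y | ε ≤ |g y|}) :=
    hK.inter_right (isClosed_le continuous_const hg.abs)
  rcases (K ∩ {y | ε ≤ |g y|}).eq_empty_or_nonempty with he | hne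
  · refine ⟨0, fun y hy => ?_⟩
    by_contra! hlt
    exact (he ▸ ⟨hy, by simpa using hlt.le⟩ : y ∈ (∅ : Set X))
  · obtain ⟨x, hx, hmin⟩ := hK'.exists_isMinOn hne hh.continuousOn
    have hpos : 0 < h x := (h_nonneg x hx.1).lt_of_ne' fun h0 => by
      have := hx.2
      rw [Set.mem_ofPred_eq, hzero x hx.1 h0, abs_zero] at this
      exact this.not_gt hε
    have hM0 : 0 ≤ M := (norm_nonneg _).trans (hM x hx.1)
    refine ⟨M / h x, fun y hy => ?_⟩
    have hy0 := h_nonneg y hy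
    rcases le_or_gt ε |g y| with hle | hlt
    · have h1 : h x ≤ h y := hmin ⟨hy, hle⟩
      calc |g y| ≤ M := hM y hy
        _ = M / h x * h x := by field_simp
        _ ≤ M / h x * h y := by gcongr
        _ ≤ _ := by linarith
    · have : 0 ≤ M / h x * h y := by positivity
      linarith

lemma Continuous.integrable_of_ae_mem_isCompact {X : Type*} [TopologicalSpace X]
    [MeasurableSpace X] [OpensMeasurableSpace X] {K : Set X} (hK : IsCompact K) {μ : Measure X}
    [IsFiniteMeasure μ] (hμ : ∀ᵐ y ∂μ, y ∈ K) {g : X → ℝ} (hg : Continuous g) :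
    Integrable g μ := by
  obtain ⟨M, hM⟩ := hK.exists_bound_of_continuousOn hg.continuousOn
  exact .of_bound hg.measurable.aestronglyMeasurable M (hμ.mono hM)

/-- If probability measures carried by a compact set concentrate on the zero set of `h ≥ 0`, then
they integrate to `0`, in the limit, every continuous function vanishing on that zero set. -/
lemma tendsto_integral_zero_of_concentration {X ι : Type*} [TopologicalSpace X]
    [MeasurableSpace X] [OpensMeasurableSpace X] {K : Set X} (hK : IsCompact K) {l : Filter ι}
    {μ : ι → Measure X} (hprob : ∀ᶠ n in l, IsProbabilityMeasure (μ n))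
    (hμ : ∀ᶠ n in l, ∀ᵐ y ∂(μ n), y ∈ K) {g h : X → ℝ} (hg : Continuous g) (hh : Continuous h)
    (h_nonneg : ∀ y ∈ K, 0 ≤ h y) (hzero : ∀ y ∈ K, h y = 0 → g y = 0)
    (hlim : Tendsto (fun n => ∫ y, h y ∂(μ n)) l (𝓝 0)) :
    Tendsto (fun n => ∫ y, g y ∂(μ n)) l (𝓝 0) := by
  rw [Metric.tendsto_nhds]
  intro ε hε
  obtain ⟨C, hC⟩ := hK.exists_abs_le_add_mul hg hh h_nonneg hzero (half_pos hε)
  have hC' : Tendsto (fun n => C * ∫ y, h y ∂(μ n)) l (𝓝 0) := by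
    simpa using hlim.const_mul C
  filter_upwards [hprob, hμ, hC'.eventually_lt_const (half_pos hε)] with n h1 h2 h3
  have hi : Integrable h (μ n) := hh.integrable_of_ae_mem_isCompact hK h2
  rw [Real.dist_eq, sub_zero]
  calc |∫ y, g y ∂(μ n)| ≤ ∫ y, |g y| ∂(μ n) := abs_integral_le_integral_abs
    _ ≤ ∫ y, (ε / 2 + C * h y) ∂(μ n) :=
      integral_mono_ae (hg.abs.integrable_of_ae_mem_isCompact hK h2)
        ((integrable_const _).add (hi.const_mul C)) (h2.mono hC)
    _ = ε / 2 + C * ∫ y, h y ∂(μ n) := by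
      rw [integral_add (integrable_const _) (hi.const_mul C), integral_const_mul]
      simp
    _ < ε := by linarith

/-- As `β → 0+`, `Dir(βα)` converges weakly (narrowly) to `|α|⁻¹ Σ_i α_i δ_{e_i}`,
where the `e_i` are the vertices of the simplex, and as `β → +∞` it converges weakly
to the Dirac measure `δ_{α/|α|}`. -/
theorem dirichlet_weak_limits {k : ℕ} (α : Fin (k + 1) → ℝ) (hα : ∀ i, 0 < α i)
    (f : BoundedContinuousFunction (Fin (k + 1) → ℝ) ℝ) :
    Tendsto (fun β : ℝ => ∫ y, f y ∂(dirichlet fun i => β * α i))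
        (nhdsWithin 0 (Set.Ioi 0))
        (nhds (∑ i, (α i / ∑ j, α j) * f (Pi.single i 1)))
    ∧ Tendsto (fun β : ℝ => ∫ y, f y ∂(dirichlet fun i => β * α i))
        atTop (nhds (f fun i => α i / ∑ j, α j)) := by
  have hsum : 0 < ∑ i, α i := Finset.sum_pos (fun i _ => hα i) Finset.univ_nonempty
  set S := ∑ i, α i with hS
  have hpos : ∀ {β : ℝ}, 0 < β → ∀ i, 0 < β * α i := fun hβ i => mul_pos hβ (hα i)
  have hK := isCompact_stdSimplex ℝ (Fin (k + 1))
  have hint : ∀ {β : ℝ}, 0 < β → ∀ {g : (Fin (k + 1) → ℝ) → ℝ}, Continuous g →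
      Integrable g (dirichlet fun i => β * α i) := fun hβ g hg => by
    have := isProbabilityMeasure_dirichlet (hpos hβ)
    exact hg.integrable_of_ae_mem_isCompact hK (ae_dirichlet_mem_stdSimplex (hpos hβ))
  have hmean : ∀ {β : ℝ}, 0 < β → ∀ i, ∫ y, y i ∂(dirichlet fun i => β * α i) = α i / S := by
    intro β hβ i
    rw [integral_eval_dirichlet (hpos hβ), ← Finset.mul_sum, mul_div_mul_left _ _ hβ.ne']
  have hsq : ∀ {β : ℝ}, 0 < β → ∀ i, ∫ y, y i ^ 2 ∂(dirichlet fun i => β * α i) =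
      α i / S * ((β * α i + 1) / (β * S + 1)) := by
    intro β hβ i
    rw [integral_eval_sq_dirichlet (hpos hβ), ← Finset.mul_sum, mul_div_mul_left _ _ hβ.ne']
  constructor
  · have hev : ∀ᶠ β : ℝ in 𝓝[>] 0, 0 < β := self_mem_nhdsWithin
    have hlim : Tendsto (fun β : ℝ => ∫ y, ∑ i, (y i - y i ^ 2) ∂(dirichlet fun i => β * α i))
        (𝓝[>] 0) (𝓝 0) := by
      have h : Tendsto (fun β : ℝ => ∑ i, (α i / S - α i / S * ((β * α i + 1) / (β * S + 1))))
          (𝓝[>] 0) (𝓝 (∑ i, (α i / S - α i / S * ((0 * α i + 1) / (0 * S + 1))))) := by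
        refine (ContinuousAt.tendsto ?_).mono_left nhdsWithin_le_nhds
        fun_prop (disch := simp)
      simp only [zero_mul, zero_add, div_one, mul_one, sub_self, Finset.sum_const_zero] at h
      refine h.congr' (hev.mono fun β hβ => ?_)
      beta_reduce
      rw [integral_finsetSum _ fun i _ => hint hβ (by fun_prop)]
      refine Finset.sum_congr rfl fun i _ => ?_
      rw [integral_sub (hint hβ (by fun_prop)) (hint hβ (by fun_prop)), hmean hβ, hsq hβ]
    have hle : ∀ y ∈ stdSimplex ℝ (Fin (k + 1)), ∀ i, 0 ≤ y i - y i ^ 2 := fun y hy i => by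
      have h0 := hy.1 i
      have h1 : y i ≤ 1 := hy.2 ▸ Finset.single_le_sum (fun i _ => hy.1 i) (Finset.mem_univ i)
      nlinarith
    have key := tendsto_integral_zero_of_concentration hK
      (hev.mono fun β hβ => isProbabilityMeasure_dirichlet (hpos hβ))
      (hev.mono fun β hβ => ae_dirichlet_mem_stdSimplex (hpos hβ))
      (g := fun y => f y - ∑ i, y i * f (Pi.single i 1))
      (h := fun y => ∑ i, (y i - y i ^ 2)) (by fun_prop) (by fun_prop)
      (fun y hy => Finset.sum_nonneg fun i _ => hle y hy i)
      (fun y hy h0 => by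
        have h1 := (Finset.sum_eq_zero_iff_of_nonneg fun i _ => hle y hy i).1 h0
        obtain ⟨j, -, hj⟩ := Finset.exists_ne_zero_of_sum_ne_zero
          (s := Finset.univ) (f := y) (by rw [hy.2]; exact one_ne_zero)
        have hj1 : y j = 1 := by
          have := h1 j (Finset.mem_univ j)
          exact mul_left_cancel₀ hj (by linarith)
        have hy' : y = Pi.single j 1 := by
          ext i
          rcases eq_or_ne i j with rfl | hij
          · simpa using hj1
          · rw [Pi.single_eq_of_ne hij]
            have h2 := hy.2
            rw [← Finset.add_sum_erase _ _ (Finset.mem_univ j), hj1, add_eq_left] at h2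
            exact (Finset.sum_eq_zero_iff_of_nonneg fun i _ => hy.1 i).1 h2 i (by simp [hij])
        rw [hy']
        simp [Pi.single_apply]) hlim
    have h2 := key.add_const (∑ i, α i / S * f (Pi.single i 1))
    rw [zero_add] at h2
    refine h2.congr' (hev.mono fun β hβ => ?_)
    rw [integral_sub (hint hβ f.continuous) (hint hβ (by fun_prop)),
      integral_finsetSum _ fun i _ => hint hβ (by fun_prop)]
    simp [integral_mul_const, hmean hβ]
  · have hev : ∀ᶠ β : ℝ in atTop, 0 < β := eventually_gt_atTop 0
    have hlim : Tendsto (fun β : ℝ => ∫ y, ∑ i, (y i - α i / S) ^ 2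
        ∂(dirichlet fun i => β * α i)) atTop (𝓝 0) := by
      have h : Tendsto (fun β : ℝ => ∑ i, (α i / S * ((α i + β⁻¹) / (S + β⁻¹)) - (α i / S) ^ 2))
          atTop (𝓝 (∑ i, (α i / S * ((α i + 0) / (S + 0)) - (α i / S) ^ 2))) := by
        refine tendsto_finsetSum _ fun i _ => ((Tendsto.div ?_ ?_ ?_).const_mul _).sub_const _
        · exact tendsto_inv_atTop_zero.const_add _
        · exact tendsto_inv_atTop_zero.const_add _
        · simpa using hsum.ne'
      simp only [add_zero, ← sq, sub_self, Finset.sum_const_zero] at h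
      refine h.congr' (hev.mono fun β hβ => ?_)
      beta_reduce
      rw [integral_finsetSum _ fun i _ => hint hβ (by fun_prop)]
      refine Finset.sum_congr rfl fun i _ => ?_
      have := isProbabilityMeasure_dirichlet (hpos hβ)
      simp only [sub_sq]
      rw [integral_add (hint hβ (by fun_prop)) (hint hβ (by fun_prop)),
        integral_sub (hint hβ (by fun_prop)) (hint hβ (by fun_prop)), integral_mul_const,
        integral_const_mul, hmean hβ, hsq hβ, integral_const, probReal_univ, one_smul]
      field_simp
      ring
    have key := tendsto_integral_zero_of_concentration hK
      (hev.mono fun β hβ => isProbabilityMeasure_dirichlet (hpos hβ))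
      (hev.mono fun β hβ => ae_dirichlet_mem_stdSimplex (hpos hβ))
      (g := fun y => f y - f fun i => α i / S)
      (h := fun y => ∑ i, (y i - α i / S) ^ 2) (by fun_prop) (by fun_prop)
      (fun y hy => Finset.sum_nonneg fun i _ => sq_nonneg _)
      (fun y hy h0 => by
        have h1 := (Finset.sum_eq_zero_iff_of_nonneg fun i _ => sq_nonneg (y i - α i / S)).1 h0
        have hy' : y = fun i => α i / S := by
          ext i
          exact sub_eq_zero.1 (pow_eq_zero_iff two_ne_zero |>.1 (h1 i (Finset.mem_univ i)))
        rw [← hy', sub_self]) hlim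
    have h2 := key.add_const (f fun i => α i / S)
    rw [zero_add] at h2
    refine h2.congr' (hev.mono fun β hβ => ?_)
    have := isProbabilityMeasure_dirichlet (hpos hβ)
    rw [integral_sub (hint hβ f.continuous) (integrable_const _)]
    simp
end
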